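/- arXiv:1910.06231 — 5 statements merged into one kernel-verified Lean document; each statement's English description precedes it below -/
import Mathlib

section
/- Let A be a finite set of lines in ℝ² in general position and let r₁, r be positive integers with 1 ≤ r₁ ≤ r − 1. Suppose a line ℓ induces a partition of ℝ² into two closed half-planes (C₁, C₂), and C₁ is r₁-critical for A. Then μ_A(C₂) > (3/2)^{r₁/r}·|A|^{1 − r₁/r}. -/
open scoped Classical

/-- A line in the plane: the solution set of `a*x + b*y = c` with `(a,b) ≠ (0,0)`. -/
def IsLine (L : Set (ℝ × ℝ)) : Prop :=
  ∃ a b c : ℝ, (a, b) ≠ (0, 0) ∧ L = {p : ℝ × ℝ | a * p.1 + b * p.2 = c}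

/-- The incidence set of a finite family of lines: all pairwise intersection points. -/
def incSet (L : Finset (Set (ℝ × ℝ))) : Set (ℝ × ℝ) :=
  {p | ∃ ℓ₁ ∈ L, ∃ ℓ₂ ∈ L, ℓ₁ ≠ ℓ₂ ∧ p ∈ ℓ₁ ∧ p ∈ ℓ₂}

/-- Two lines are non-parallel if they meet in exactly one point. -/
def NotParallel (L₁ L₂ : Set (ℝ × ℝ)) : Prop := ∃! p : ℝ × ℝ, p ∈ L₁ ∩ L₂

/-- No two lines of the family are parallel. -/
def PairwiseNonParallel (L : Finset (Set (ℝ × ℝ))) : Prop :=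
  ∀ ℓ₁ ∈ L, ∀ ℓ₂ ∈ L, ℓ₁ ≠ ℓ₂ → NotParallel ℓ₁ ℓ₂

/-- A family of lines is in general position: no two parallel, no three concurrent, and any
three collinear points of the incidence set lie on a common line of the family. -/
def GenPos (L : Finset (Set (ℝ × ℝ))) : Prop :=
  PairwiseNonParallel L ∧
  (∀ ℓ₁ ∈ L, ∀ ℓ₂ ∈ L, ∀ ℓ₃ ∈ L, ℓ₁ ≠ ℓ₂ → ℓ₁ ≠ ℓ₃ → ℓ₂ ≠ ℓ₃ →
    ¬ ∃ p : ℝ × ℝ, p ∈ ℓ₁ ∧ p ∈ ℓ₂ ∧ p ∈ ℓ₃) ∧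
  (∀ p q s : ℝ × ℝ, p ∈ incSet L → q ∈ incSet L → s ∈ incSet L →
    p ≠ q → p ≠ s → q ≠ s → Collinear ℝ ({p, q, s} : Set (ℝ × ℝ)) →
    ∃ ℓ ∈ L, p ∈ ℓ ∧ q ∈ ℓ ∧ s ∈ ℓ)

/-- `mu A K` is the largest cardinality of a subset of `A` whose incidence set lies in `K`. -/
noncomputable def mu (A : Finset (Set (ℝ × ℝ))) (K : Set (ℝ × ℝ)) : ℕ :=
  (A.powerset.filter (fun A' => incSet A' ⊆ K)).sup Finset.card

/-- A convex partition of the plane into `r` parts: closed convex sets covering `ℝ²`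
with pairwise disjoint interiors. -/
def ConvexPartition {r : ℕ} (C : Fin r → Set (ℝ × ℝ)) : Prop :=
  (∀ j, IsClosed (C j)) ∧ (∀ j, Convex ℝ (C j)) ∧
  (⋃ j, C j) = Set.univ ∧
  Pairwise fun i j => interior (C i) ∩ interior (C j) = ∅

/-- A closed half-plane. -/
def IsHalfPlane (H : Set (ℝ × ℝ)) : Prop :=
  ∃ a b c : ℝ, (a, b) ≠ (0, 0) ∧ H = {p : ℝ × ℝ | a * p.1 + b * p.2 ≤ c}

/-- A closed half-plane `H` is `r₁`-critical for `A` if it encloses a subset of `A` of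
cardinality at least `(2|A|/3)^{r₁/r} − 2`, but its interior encloses no such subset. -/
def IsCritical (A : Finset (Set (ℝ × ℝ))) (r₁ r : ℕ) (H : Set (ℝ × ℝ)) : Prop :=
  IsHalfPlane H ∧
  (∃ A' ⊆ A, incSet A' ⊆ H ∧
    (2 * A.card / 3 : ℝ) ^ ((r₁ : ℝ) / r) - 2 ≤ (A'.card : ℝ)) ∧
  ¬ ∃ A' ⊆ A, incSet A' ⊆ interior H ∧
    (2 * A.card / 3 : ℝ) ^ ((r₁ : ℝ) / r) - 2 ≤ (A'.card : ℝ)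

/-- A form of Mirsky's theorem: if every chain of a strict order in a finite set has at most `m`
elements and every antichain at most `k`, then the set has at most `m * k` elements. -/
theorem card_le_chain_mul_antichain {ι : Type*} (R : ι → ι → Prop)
    (hirr : ∀ x, ¬ R x x) (htr : ∀ x y z, R x y → R y z → R x z) (S : Finset ι) (m k : ℕ)
    (hchain : ∀ T ⊆ S, (∀ x ∈ T, ∀ y ∈ T, x ≠ y → R x y ∨ R y x) → T.card ≤ m)
    (hanti : ∀ T ⊆ S, (∀ x ∈ T, ∀ y ∈ T, ¬ R x y) → T.card ≤ k) :
    S.card ≤ m * k := by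
  let F : ι → Finset (Finset ι) := fun i => S.powerset.filter (fun T =>
    (∀ x ∈ T, ∀ y ∈ T, x ≠ y → R x y ∨ R y x) ∧ ∀ x ∈ T, R x i)
  let f : ι → ℕ := fun i => (F i).sup Finset.card
  have attained : ∀ i, ∃ T ∈ F i, f i = T.card := fun i =>
    Finset.exists_mem_eq_sup (F i) ⟨∅, by simp [F]⟩ Finset.card
  have extend : ∀ i ∈ S, ∃ T ⊆ S, (∀ x ∈ T, ∀ y ∈ T, x ≠ y → R x y ∨ R y x) ∧
      (∀ x ∈ T, x = i ∨ R x i) ∧ T.card = f i + 1 := by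
    intro i hi
    obtain ⟨T, hT, hcard⟩ := attained i
    simp only [F, Finset.mem_filter, Finset.mem_powerset] at hT
    obtain ⟨hTS, hc, hb⟩ := hT
    refine ⟨insert i T, Finset.insert_subset hi hTS, ?_, ?_, ?_⟩
    · intro x hx y hy hxy
      rw [Finset.mem_insert] at hx hy
      rcases hx with rfl | hx <;> rcases hy with rfl | hy
      · exact absurd rfl hxy
      · exact Or.inr (hb y hy)
      · exact Or.inl (hb x hx)
      · exact hc x hx y hy hxy
    · intro x hx
      rw [Finset.mem_insert] at hx
      exact hx.imp id (hb x)
    · rw [Finset.card_insert_of_notMem (fun h => hirr i (hb i h)), hcard]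
  have hlt : ∀ i ∈ S, f i < m := by
    intro i hi
    obtain ⟨T, hTS, hc, -, hcard⟩ := extend i hi
    have := hchain T hTS hc
    omega
  have hmono : ∀ i ∈ S, ∀ j ∈ S, R i j → f i < f j := by
    intro i hi j _ hij
    obtain ⟨T, hTS, hc, hb, hcard⟩ := extend i hi
    have hT : T ∈ F j := by
      simp only [F, Finset.mem_filter, Finset.mem_powerset]
      refine ⟨hTS, hc, fun x hx => ?_⟩
      rcases hb x hx with rfl | h
      · exact hij
      · exact htr _ _ _ h hij
    have : T.card ≤ f j := Finset.le_sup (f := Finset.card) hT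
    omega
  have := Finset.card_le_mul_card_image_of_maps_to (s := S) (t := Finset.range m) (f := f)
    (fun i hi => Finset.mem_range.2 (hlt i hi)) k (fun v _ => by
      refine hanti _ (Finset.filter_subset _ _) ?_
      intro x hx y hy hxy
      rw [Finset.mem_filter] at hx hy
      have := hmono x hx.1 y hy.1 hxy
      omega)
  rwa [Finset.card_range, mul_comm] at this

/-- In coordinates adapted to the line `a x + b y = c`, every line is a graph over the normal
direction or parallel to the given line. -/
theorem IsLine.graph_or_parallel {L : Set (ℝ × ℝ)} (hL : IsLine L) {a b : ℝ} (c : ℝ)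
    (hab : (a, b) ≠ (0, 0)) :
    (∃ p s : ℝ, L = {q : ℝ × ℝ | b * q.1 - a * q.2 = p + s * (a * q.1 + b * q.2 - c)}) ∨
      ∃ d : ℝ, L = {q : ℝ × ℝ | a * q.1 + b * q.2 = d} := by
  obtain ⟨u, v, w, huv, rfl⟩ := hL
  have hN : a ^ 2 + b ^ 2 ≠ 0 := by
    intro h
    apply hab
    have ha : a = 0 := by nlinarith [sq_nonneg a, sq_nonneg b]
    have hb : b = 0 := by nlinarith [sq_nonneg a, sq_nonneg b]
    rw [ha, hb]
  by_cases hD : u * b - v * a = 0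
  · right
    have hM : u * a + v * b ≠ 0 := by
      intro h
      apply huv
      have hu : u * (a ^ 2 + b ^ 2) = 0 := by linear_combination a * h + b * hD
      have hv : v * (a ^ 2 + b ^ 2) = 0 := by linear_combination b * h - a * hD
      rw [(mul_eq_zero.1 hu).resolve_right hN, (mul_eq_zero.1 hv).resolve_right hN]
    refine ⟨w * (a ^ 2 + b ^ 2) / (u * a + v * b), ?_⟩
    ext q
    simp only [Set.mem_ofPred_eq]
    rw [eq_div_iff hM]
    constructor
    · intro h
      linear_combination (a ^ 2 + b ^ 2) * h - (b * q.1 - a * q.2) * hD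
    · intro h
      apply mul_left_cancel₀ hN
      linear_combination h + (b * q.1 - a * q.2) * hD
  · left
    refine ⟨(w * (a ^ 2 + b ^ 2) - (u * a + v * b) * c) / (u * b - v * a),
      -(u * a + v * b) / (u * b - v * a), ?_⟩
    ext q
    simp only [Set.mem_ofPred_eq]
    rw [div_mul_eq_mul_div, ← add_div, eq_div_iff hD]
    constructor
    · intro h
      linear_combination (a ^ 2 + b ^ 2) * h
    · intro h
      apply mul_left_cancel₀ hN
      linear_combination h

theorem card_le_mu {A T : Finset (Set (ℝ × ℝ))} {K : Set (ℝ × ℝ)} (hT : T ⊆ A)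
    (hK : incSet T ⊆ K) : T.card ≤ mu A K :=
  Finset.le_sup (f := Finset.card) (Finset.mem_filter.2 ⟨Finset.mem_powerset.2 hT, hK⟩)

theorem exists_card_eq_mu (A : Finset (Set (ℝ × ℝ))) (K : Set (ℝ × ℝ)) :
    ∃ T ⊆ A, incSet T ⊆ K ∧ T.card = mu A K := by
  have hempty : ∅ ∈ A.powerset.filter (fun A' => incSet A' ⊆ K) := by
    refine Finset.mem_filter.2 ⟨Finset.empty_mem_powerset A, ?_⟩
    rintro q ⟨L, hL, -⟩
    exact absurd hL (Finset.notMem_empty L)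
  obtain ⟨T, hT, hcard⟩ := Finset.exists_mem_eq_sup
    (A.powerset.filter (fun A' => incSet A' ⊆ K)) ⟨∅, hempty⟩ Finset.card
  rw [Finset.mem_filter, Finset.mem_powerset] at hT
  exact ⟨T, hT.1, hT.2, hcard.symm⟩

/-- Of the two sides of a line, one open and one closed, the product of the values of `mu` is at
least the number of lines of the family that are not parallel to it. -/
theorem card_le_mu_mul_mu_add_one {A : Finset (Set (ℝ × ℝ))} (hlines : ∀ ℓ ∈ A, IsLine ℓ)
    (hA : PairwiseNonParallel A) {a b : ℝ} (c : ℝ) (hab : (a, b) ≠ (0, 0)) :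
    A.card ≤ mu A {p : ℝ × ℝ | a * p.1 + b * p.2 < c} *
      mu A {p : ℝ × ℝ | c ≤ a * p.1 + b * p.2} + 1 := by
  let G : Set (ℝ × ℝ) → Prop := fun L =>
    ∃ p s : ℝ, L = {q : ℝ × ℝ | b * q.1 - a * q.2 = p + s * (a * q.1 + b * q.2 - c)}
  have hpar : (A.filter (fun L => ¬ G L)).card ≤ 1 := by
    refine Finset.card_le_one.2 fun L₁ h₁ L₂ h₂ => ?_
    rw [Finset.mem_filter] at h₁ h₂
    obtain ⟨d₁, e₁⟩ := ((hlines L₁ h₁.1).graph_or_parallel c hab).resolve_left h₁.2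
    obtain ⟨d₂, e₂⟩ := ((hlines L₂ h₂.1).graph_or_parallel c hab).resolve_left h₂.2
    by_contra hne
    obtain ⟨q, ⟨hq₁, hq₂⟩, -⟩ := hA L₁ h₁.1 L₂ h₂.1 hne
    apply hne
    rw [e₁, Set.mem_ofPred_eq] at hq₁
    rw [e₂, Set.mem_ofPred_eq] at hq₂
    rw [e₁, e₂, ← hq₁, ← hq₂]
  have hex : ∀ L, ∃ p s : ℝ, G L →
      L = {q : ℝ × ℝ | b * q.1 - a * q.2 = p + s * (a * q.1 + b * q.2 - c)} := by
    intro L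
    by_cases h : G L
    · obtain ⟨p, s, h⟩ := h
      exact ⟨p, s, fun _ => h⟩
    · exact ⟨0, 0, fun h' => absurd h' h⟩
  choose p s hps using hex
  have hmem : ∀ L, G L → ∀ q ∈ L, b * q.1 - a * q.2 = p L + s L * (a * q.1 + b * q.2 - c) := by
    intro L hL q hq
    rw [hps L hL] at hq
    exact hq
  have hslope : ∀ L₁ ∈ A, ∀ L₂ ∈ A, G L₁ → G L₂ → L₁ ≠ L₂ → s L₁ ≠ s L₂ := by
    intro L₁ h₁ L₂ h₂ g₁ g₂ hne hs
    obtain ⟨q, ⟨hq₁, hq₂⟩, -⟩ := hA L₁ h₁ L₂ h₂ hne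
    have e₁ := hmem L₁ g₁ q hq₁
    have e₂ := hmem L₂ g₂ q hq₂
    rw [hs] at e₁
    have hp : p L₁ = p L₂ := by linarith
    exact hne (by rw [hps L₁ g₁, hps L₂ g₂, hs, hp])
  have hmain := card_le_chain_mul_antichain (fun L₁ L₂ => s L₁ < s L₂ ∧ p L₁ < p L₂)
    (fun _ h => lt_irrefl _ h.1) (fun _ _ _ h h' => ⟨h.1.trans h'.1, h.2.trans h'.2⟩)
    (A.filter G) (mu A {p : ℝ × ℝ | a * p.1 + b * p.2 < c})
    (mu A {p : ℝ × ℝ | c ≤ a * p.1 + b * p.2}) ?_ ?_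
  · have := Finset.card_filter_add_card_filter_not (s := A) G
    omega
  · intro T hT hc
    refine card_le_mu (hT.trans (Finset.filter_subset _ _)) ?_
    rintro q ⟨L₁, h₁, L₂, h₂, hne, hq₁, hq₂⟩
    have e₁ := hmem L₁ (Finset.mem_filter.1 (hT h₁)).2 q hq₁
    have e₂ := hmem L₂ (Finset.mem_filter.1 (hT h₂)).2 q hq₂
    rw [Set.mem_ofPred_eq]
    by_contra hcon
    rcases hc L₁ h₁ L₂ h₂ hne with h | h <;> nlinarith [h.1, h.2]
  · intro T hT hc
    refine card_le_mu (hT.trans (Finset.filter_subset _ _)) ?_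
    rintro q ⟨L₁, h₁, L₂, h₂, hne, hq₁, hq₂⟩
    obtain ⟨m₁, g₁⟩ := Finset.mem_filter.1 (hT h₁)
    obtain ⟨m₂, g₂⟩ := Finset.mem_filter.1 (hT h₂)
    have e₁ := hmem L₁ g₁ q hq₁
    have e₂ := hmem L₂ g₂ q hq₂
    rw [Set.mem_ofPred_eq]
    by_contra hcon
    rcases lt_or_gt_of_ne (hslope L₁ m₁ L₂ m₂ g₁ g₂ hne) with h | h
    · exact hc L₁ h₁ L₂ h₂ ⟨h, by nlinarith⟩
    · exact hc L₂ h₂ L₁ h₁ ⟨h, by nlinarith⟩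

/-- If a line splits the plane into half-planes `(C₁, C₂)` and `C₁` is `r₁`-critical for `A`,
then `μ_A(C₂) > (3/2)^{r₁/r}·|A|^{1 − r₁/r}`. -/
theorem critical_complement (A : Finset (Set (ℝ × ℝ)))
    (hlines : ∀ ℓ ∈ A, IsLine ℓ) (hgp : GenPos A)
    (r₁ r : ℕ) (hr₁ : 1 ≤ r₁) (hr : r₁ ≤ r - 1)
    (a b c : ℝ) (hab : (a, b) ≠ (0, 0))
    (hcrit : IsCritical A r₁ r {p : ℝ × ℝ | a * p.1 + b * p.2 ≤ c}) :
    (3 / 2 : ℝ) ^ ((r₁ : ℝ) / r) * (A.card : ℝ) ^ (1 - (r₁ : ℝ) / r) <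
      (mu A {p : ℝ × ℝ | c ≤ a * p.1 + b * p.2} : ℝ) := by
  obtain ⟨-, -, hint⟩ := hcrit
  have hα : (0 : ℝ) < (r₁ : ℝ) / r := by
    have h₁ : (0 : ℝ) < r₁ := by exact_mod_cast hr₁
    have h₂ : (0 : ℝ) < r := by exact_mod_cast (by omega : 0 < r)
    positivity
  generalize (r₁ : ℝ) / r = α at hα hint ⊢
  have hopen : {p : ℝ × ℝ | a * p.1 + b * p.2 < c} ⊆
      interior {p : ℝ × ℝ | a * p.1 + b * p.2 ≤ c} :=
    interior_maximal (Set.ofPred_subset_ofPred.2 fun _ => le_of_lt) (isOpen_lt (by fun_prop) (by fun_prop))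
  have hcard := card_le_mu_mul_mu_add_one hlines hgp.1 c hab
  have hm : (mu A {p : ℝ × ℝ | a * p.1 + b * p.2 < c} : ℝ) < (2 * A.card / 3 : ℝ) ^ α - 2 := by
    obtain ⟨T, hTA, hT, hTcard⟩ := exists_card_eq_mu A {p : ℝ × ℝ | a * p.1 + b * p.2 < c}
    by_contra! h
    exact hint ⟨T, hTA, hT.trans hopen, by rwa [hTcard]⟩
  have hpos : 0 < A.card := by
    by_contra! h
    have h0 : A.card = 0 := by omega
    rw [h0, Nat.cast_zero, mul_zero, zero_div, Real.zero_rpow hα.ne'] at hm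
    have := Nat.cast_nonneg (α := ℝ) (mu A {p : ℝ × ℝ | a * p.1 + b * p.2 < c})
    linarith
  have hk : 1 ≤ mu A {p : ℝ × ℝ | c ≤ a * p.1 + b * p.2} := by
    obtain ⟨L, hL⟩ := Finset.card_pos.1 hpos
    refine card_le_mu (T := {L}) (by simpa using hL) ?_
    rintro q ⟨L₁, h₁, L₂, h₂, hne, -⟩
    exact absurd ((Finset.mem_singleton.1 h₁).trans (Finset.mem_singleton.1 h₂).symm) hne
  have hn : (0 : ℝ) < A.card := by exact_mod_cast hpos
  have hcard' : (A.card : ℝ) ≤ (mu A {p : ℝ × ℝ | a * p.1 + b * p.2 < c} : ℝ) *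
      (mu A {p : ℝ × ℝ | c ≤ a * p.1 + b * p.2} : ℝ) + 1 := by exact_mod_cast hcard
  have hk' : (1 : ℝ) ≤ (mu A {p : ℝ × ℝ | c ≤ a * p.1 + b * p.2} : ℝ) := by exact_mod_cast hk
  have ht : (0 : ℝ) < (2 * A.card / 3 : ℝ) ^ α := by positivity
  have heq : (3 / 2 : ℝ) ^ α * (A.card : ℝ) ^ (1 - α) = A.card / (2 * A.card / 3 : ℝ) ^ α := by
    rw [eq_div_iff ht.ne', mul_right_comm, ← Real.mul_rpow (by norm_num) (by positivity),
      show (3 / 2 : ℝ) * (2 * A.card / 3) = A.card by ring, ← Real.rpow_add hn,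
      add_sub_cancel, Real.rpow_one]
  rw [heq, div_lt_iff₀ ht]
  nlinarith
end

section
/- Let A and B be two finite sets of lines in ℝ² such that A ∪ B is in general position, let r ≥ 2 be an integer, and let r₁ be an integer with 1 ≤ r₁ ≤ r − 1. If there exist two closed half-planes H and H', both r₁-critical for A, with μ_B(H) ≥ (2|B|/3)^{r₁/r} − 2 and μ_B(H') ≤ (2|B|/3)^{r₁/r} − 2, then there exists a closed half-plane H'' which is r₁-critical for A and satisfies μ_B(H'') = ⌈(2|B|/3)^{r₁/r}⌉ − 2. -/
open scoped Classical

open Filter Topology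

/-- The signed height of a point in the direction `(cos θ, sin θ)`. -/
noncomputable def height (θ : ℝ) (p : ℝ × ℝ) : ℝ := Real.cos θ * p.1 + Real.sin θ * p.2

lemma continuous_height_left (p : ℝ × ℝ) : Continuous fun θ => height θ p := by
  unfold height; fun_prop

lemma height_add (θ s : ℝ) (p : ℝ × ℝ) :
    height (θ + s) p = Real.cos s * height θ p + Real.sin s * height (θ + Real.pi / 2) p := by
  simp only [height, Real.cos_add, Real.sin_add, Real.cos_pi_div_two, Real.sin_pi_div_two]
  ring

lemma eq_smul_of_height_eq {θ : ℝ} {p q : ℝ × ℝ} (h : height θ p = height θ q) :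
    ∃ r : ℝ, p = r • (-Real.sin θ, Real.cos θ) + q := by
  have h1 := Real.sin_sq_add_cos_sq θ
  unfold height at h
  refine ⟨-(p.1 - q.1) * Real.sin θ + (p.2 - q.2) * Real.cos θ, ?_⟩
  ext
  · simp only [Prod.smul_mk, smul_eq_mul, Prod.fst_add]
    linear_combination -(p.1 - q.1) * h1 + Real.cos θ * h
  · simp only [Prod.smul_mk, smul_eq_mul, Prod.snd_add]
    linear_combination -(p.2 - q.2) * h1 + Real.sin θ * h

lemma isHalfPlane_height (θ t : ℝ) : IsHalfPlane {p | height θ p ≤ t} := by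
  refine ⟨Real.cos θ, Real.sin θ, t, ?_, rfl⟩
  intro h
  have h1 := Real.sin_sq_add_cos_sq θ
  simp only [Prod.mk.injEq] at h
  simp [h.1, h.2] at h1

lemma IsHalfPlane.exists_height {H : Set (ℝ × ℝ)} (h : IsHalfPlane H) :
    ∃ θ t : ℝ, -Real.pi < θ ∧ θ ≤ Real.pi ∧ H = {p | height θ p ≤ t} := by
  obtain ⟨a, b, c, hab, rfl⟩ := h
  set z : ℂ := ⟨a, b⟩ with hz
  have hz0 : z ≠ 0 := by
    intro h0
    apply hab
    have h1 := congrArg Complex.re h0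
    have h2 := congrArg Complex.im h0
    simp only [hz, Complex.zero_re, Complex.zero_im] at h1 h2
    rw [h1, h2]
  have hpos : 0 < ‖z‖ := norm_pos_iff.mpr hz0
  have ha : a = ‖z‖ * Real.cos z.arg := by
    rw [Complex.norm_mul_cos_arg]
  have hb : b = ‖z‖ * Real.sin z.arg := by
    rw [Complex.norm_mul_sin_arg]
  refine ⟨z.arg, c / ‖z‖, Complex.neg_pi_lt_arg z, Complex.arg_le_pi z, ?_⟩
  ext p
  simp only [Set.mem_ofPred_eq, height]
  rw [le_div_iff₀ hpos]
  have : a * p.1 + b * p.2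
      = (Real.cos z.arg * p.1 + Real.sin z.arg * p.2) * ‖z‖ := by
    linear_combination p.1 * ha + p.2 * hb
  rw [this]

lemma interior_height_le (θ t : ℝ) :
    interior {p | height θ p ≤ t} = {p | height θ p < t} := by
  let f : ℝ × ℝ →L[ℝ] ℝ :=
    Real.cos θ • ContinuousLinearMap.fst ℝ ℝ ℝ + Real.sin θ • ContinuousLinearMap.snd ℝ ℝ ℝ
  have hf : ∀ p, f p = height θ p := fun p => by simp [f, height]
  have hsurj : Function.Surjective f := by
    intro x
    refine ⟨(x * Real.cos θ, x * Real.sin θ), ?_⟩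
    rw [hf, height]
    linear_combination x * Real.sin_sq_add_cos_sq θ
  have h := (f.isOpenMap hsurj).preimage_interior_eq_interior_preimage f.continuous (Set.Iic t)
  rw [interior_Iic] at h
  have h1 : f ⁻¹' Set.Iic t = {p | height θ p ≤ t} := by ext p; simp [hf]
  have h2 : f ⁻¹' Set.Iio t = {p | height θ p < t} := by ext p; simp [hf]
  rw [← h1, ← h2, h]

lemma incSet_mono {L M : Finset (Set (ℝ × ℝ))} (h : L ⊆ M) : incSet L ⊆ incSet M := by
  rintro p ⟨l, hl, l', hl', h'⟩
  exact ⟨l, h hl, l', h hl', h'⟩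

lemma incSet_eq_empty {L : Finset (Set (ℝ × ℝ))} (h : L.card ≤ 1) : incSet L = ∅ := by
  rw [Set.eq_empty_iff_forall_notMem]
  rintro p ⟨l, hl, l', hl', hne, -⟩
  exact hne (Finset.card_le_one.mp h l hl l' hl')

lemma GenPos.incSet_finite {L : Finset (Set (ℝ × ℝ))} (h : GenPos L) : (incSet L).Finite := by
  have : incSet L ⊆ ⋃ x ∈ L.offDiag, x.1 ∩ x.2 := by
    rintro p ⟨l, hl, l', hl', hne, hp⟩
    simp only [Set.mem_iUnion]
    exact ⟨(l, l'), by simp [hl, hl', hne], hp⟩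
  refine Set.Finite.subset (Set.Finite.biUnion (Finset.finite_toSet _) ?_) this
  rintro ⟨l, l'⟩ hx
  simp only [Finset.mem_coe, Finset.mem_offDiag] at hx
  exact Set.Subsingleton.finite fun p hp q hq => (h.1 l hx.1 l' hx.2.1 hx.2.2).unique hp hq

lemma GenPos.incSet_nonempty {L M : Finset (Set (ℝ × ℝ))} (h : GenPos L) (hM : M ⊆ L)
    (hc : 2 ≤ M.card) : (incSet M).Nonempty := by
  obtain ⟨l, hl, l', hl', hne⟩ := Finset.one_lt_card.mp hc
  obtain ⟨p, hp, -⟩ := h.1 l (hM hl) l' (hM hl') hne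
  exact ⟨p, l, hl, l', hl', hne, hp.1, hp.2⟩

lemma GenPos.eq_or_eq_of_mem {L : Finset (Set (ℝ × ℝ))} (h : GenPos L)
    {l l₁ l₂ : Set (ℝ × ℝ)} (hl : l ∈ L) (hl₁ : l₁ ∈ L) (hl₂ : l₂ ∈ L) (hne : l₁ ≠ l₂)
    {p : ℝ × ℝ} (hp : p ∈ l) (hp₁ : p ∈ l₁) (hp₂ : p ∈ l₂) : l = l₁ ∨ l = l₂ := by
  by_contra! hc
  exact h.2.1 l hl l₁ hl₁ l₂ hl₂ hc.1 hc.2 hne ⟨p, hp, hp₁, hp₂⟩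

lemma GenPos.notMem_incSet_erase {L M : Finset (Set (ℝ × ℝ))} (h : GenPos L) (hM : M ⊆ L)
    {l : Set (ℝ × ℝ)} (hl : l ∈ L) {p : ℝ × ℝ} (hp : p ∈ l) : p ∉ incSet (M.erase l) := by
  rintro ⟨l₁, hl₁, l₂, hl₂, hne, hp₁, hp₂⟩
  rw [Finset.mem_erase] at hl₁ hl₂
  rcases h.eq_or_eq_of_mem hl (hM hl₁.2) (hM hl₂.2) hne hp hp₁ hp₂ with h' | h'
  · exact hl₁.1 h'.symm
  · exact hl₂.1 h'.symm

lemma IsLine.mem_of_height_eq {l : Set (ℝ × ℝ)} (h : IsLine l) {θ : ℝ} {p q y : ℝ × ℝ}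
    (hp : p ∈ l) (hq : q ∈ l) (hpq : p ≠ q) (hpq' : height θ p = height θ q)
    (hy : height θ y = height θ q) : y ∈ l := by
  obtain ⟨a, b, c, -, rfl⟩ := h
  obtain ⟨r, hr⟩ := eq_smul_of_height_eq hpq'
  obtain ⟨s, hs⟩ := eq_smul_of_height_eq hy
  have hr0 : r ≠ 0 := by
    rintro rfl
    exact hpq (by simpa using hr)
  simp only [Set.mem_ofPred_eq] at hp hq ⊢
  rw [hr] at hp
  rw [hs]
  simp only [Prod.smul_mk, smul_eq_mul, Prod.fst_add, Prod.snd_add] at hp ⊢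
  have : a * (-Real.sin θ) + b * Real.cos θ = 0 := by
    apply mul_left_cancel₀ hr0
    linear_combination hp - hq
  linear_combination s * this + hq

/-- Given a finite family of lines in general position, one line of any nonempty subfamily can be
removed so that the remaining incidences on a line through `q` reduce to at most `q`. -/
lemma GenPos.exists_erase {L M : Finset (Set (ℝ × ℝ))} (hlines : ∀ l ∈ L, IsLine l)
    (h : GenPos L) (hM : M ⊆ L) (hne : M.Nonempty) (θ : ℝ) {q : ℝ × ℝ} (hq : q ∈ incSet L) :
    ∃ l ∈ M, ∀ y ∈ incSet (M.erase l), height θ y = height θ q → y = q := by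
  by_cases h1 : ∀ y ∈ incSet M, height θ y = height θ q → y = q
  · obtain ⟨l, hl⟩ := hne
    exact ⟨l, hl, fun y hy => h1 y (incSet_mono (Finset.erase_subset _ _) hy)⟩
  push Not at h1
  obtain ⟨p, hpM, hpq', hpq⟩ := h1
  obtain ⟨l₁, hl₁, l₂, hl₂, hne₁₂, hp₁, hp₂⟩ := id hpM
  by_cases h2 : ∀ y ∈ incSet M, height θ y = height θ q → y = p ∨ y = q
  · refine ⟨l₁, hl₁, fun y hy hyq => ?_⟩
    rcases h2 y (incSet_mono (Finset.erase_subset _ _) hy) hyq with rfl | h'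
    · exact absurd hy (h.notMem_incSet_erase hM (hM hl₁) hp₁)
    · exact h'
  push Not at h2
  obtain ⟨s, hsM, hsq', hsp, hsq⟩ := h2
  have hcol : Collinear ℝ ({p, q, s} : Set (ℝ × ℝ)) := by
    rw [collinear_iff_of_mem (p₀ := q) (by simp)]
    refine ⟨(-Real.sin θ, Real.cos θ), fun x hx => ?_⟩
    apply eq_smul_of_height_eq
    rcases hx with rfl | rfl | rfl
    · exact hpq'
    · rfl
    · exact hsq'
  obtain ⟨l, hl, hpl, hql, -⟩ := h.2.2 p q s (incSet_mono hM hpM) hq (incSet_mono hM hsM) hpq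
    hsp.symm hsq.symm hcol
  have hlM : l ∈ M := by
    rcases h.eq_or_eq_of_mem hl (hM hl₁) (hM hl₂) hne₁₂ hpl hp₁ hp₂ with rfl | rfl <;> assumption
  refine ⟨l, hlM, fun y hy hyq => ?_⟩
  exact absurd hy
    (h.notMem_incSet_erase hM hl ((hlines l hl).mem_of_height_eq hpl hql hpq hpq' hyq))

lemma le_mu_iff {A : Finset (Set (ℝ × ℝ))} {K : Set (ℝ × ℝ)} {n : ℕ} :
    n ≤ mu A K ↔ ∃ A' ⊆ A, n ≤ A'.card ∧ incSet A' ⊆ K := by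
  constructor
  · intro h
    have hne : (A.powerset.filter (fun A' => incSet A' ⊆ K)).Nonempty :=
      ⟨∅, by simp [incSet_eq_empty (L := ∅) (by simp)]⟩
    obtain ⟨A', hA', heq⟩ := Finset.exists_mem_eq_sup _ hne Finset.card
    simp only [Finset.mem_filter, Finset.mem_powerset] at hA'
    exact ⟨A', hA'.1, by rw [← heq]; exact h, hA'.2⟩
  · rintro ⟨A', hA', hc, hK⟩
    exact hc.trans (Finset.le_sup (f := Finset.card) (by simp [hA', hK]))

lemma exists_continuous_max {S : Set (ℝ × ℝ)} (hfin : S.Finite) (hne : S.Nonempty) :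
    ∃ g : ℝ → ℝ, Continuous g ∧ (∀ θ t, g θ ≤ t ↔ ∀ p ∈ S, height θ p ≤ t) ∧
      ∀ θ t, g θ < t ↔ ∀ p ∈ S, height θ p < t := by
  have hne' : hfin.toFinset.Nonempty := by simpa using hne
  refine ⟨fun θ => hfin.toFinset.sup' hne' (height θ), ?_, fun θ t => ?_, fun θ t => ?_⟩
  · exact Continuous.finset_sup'_apply hne' fun p _ => continuous_height_left p
  · simp [Finset.sup'_le_iff]
  · simp [Finset.sup'_lt_iff]

/-- The least height in direction `θ` at which a half-plane encloses `n` lines of `A` is a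
continuous function of `θ`. -/
lemma GenPos.exists_continuous_threshold {L A : Finset (Set (ℝ × ℝ))} (h : GenPos L)
    (hA : A ⊆ L) {n : ℕ} (hn : 2 ≤ n) (hnA : n ≤ A.card) :
    ∃ g : ℝ → ℝ, Continuous g ∧
      (∀ θ t, g θ ≤ t ↔ ∃ A' ⊆ A, n ≤ A'.card ∧ incSet A' ⊆ {p | height θ p ≤ t}) ∧
      ∀ θ t, g θ < t ↔ ∃ A' ⊆ A, n ≤ A'.card ∧ incSet A' ⊆ {p | height θ p < t} := by
  set F := A.powerset.filter (fun A' => n ≤ A'.card) with hF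
  have hmem : ∀ A', A' ∈ F ↔ A' ⊆ A ∧ n ≤ A'.card := by simp [hF]
  have hFne : F.Nonempty := ⟨A, (hmem A).2 ⟨subset_rfl, hnA⟩⟩
  have key : ∀ A' : Finset (Set (ℝ × ℝ)), ∃ g : ℝ → ℝ, A' ∈ F → Continuous g ∧
      (∀ θ t, g θ ≤ t ↔ ∀ p ∈ incSet A', height θ p ≤ t) ∧
      ∀ θ t, g θ < t ↔ ∀ p ∈ incSet A', height θ p < t := by
    intro A'
    by_cases hA' : A' ∈ F
    · have h' := (hmem A').1 hA'
      obtain ⟨g, hg⟩ := exists_continuous_max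
        (h.incSet_finite.subset (incSet_mono (h'.1.trans hA)))
        (h.incSet_nonempty (h'.1.trans hA) (hn.trans h'.2))
      exact ⟨g, fun _ => hg⟩
    · exact ⟨0, fun h' => absurd h' hA'⟩
  choose g hg using key
  refine ⟨fun θ => F.inf' hFne fun A' => g A' θ, ?_, fun θ t => ?_, fun θ t => ?_⟩
  · exact Continuous.finset_inf'_apply hFne fun A' hA' => (hg A' hA').1
  · rw [Finset.inf'_le_iff]
    constructor
    · rintro ⟨A', hA', ht⟩
      exact ⟨A', ((hmem A').1 hA').1, ((hmem A').1 hA').2, ((hg A' hA').2.1 θ t).1 ht⟩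
    · rintro ⟨A', hs, hc, ht⟩
      have hA' := (hmem A').2 ⟨hs, hc⟩
      exact ⟨A', hA', ((hg A' hA').2.1 θ t).2 ht⟩
  · rw [Finset.inf'_lt_iff]
    constructor
    · rintro ⟨A', hA', ht⟩
      exact ⟨A', ((hmem A').1 hA').1, ((hmem A').1 hA').2, ((hg A' hA').2.2 θ t).1 ht⟩
    · rintro ⟨A', hs, hc, ht⟩
      have hA' := (hmem A').2 ⟨hs, hc⟩
      exact ⟨A', hA', ((hg A' hA').2.2 θ t).2 ht⟩

/-- Points on the boundary of a half-plane separate, for small positive rotations, according to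
their position along the boundary. -/
lemma eventually_height_le {θ : ℝ} {p q : ℝ × ℝ} (h : height θ q ≤ height θ p)
    (h' : height θ p = height θ q →
      height (θ + Real.pi / 2) q ≤ height (θ + Real.pi / 2) p) :
    ∀ᶠ x in 𝓝[>] θ, height x q ≤ height x p := by
  rcases h.lt_or_eq with hlt | heq
  · have : ∀ᶠ x in 𝓝 θ, height x q < height x p :=
      (continuous_height_left q).continuousAt.eventually_lt
        (continuous_height_left p).continuousAt hlt
    exact (this.filter_mono nhdsWithin_le_nhds).mono fun x hx => hx.le
  · filter_upwards [Ioo_mem_nhdsGT (show θ < θ + Real.pi by linarith [Real.pi_pos])] with x hx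
    have e : x = θ + (x - θ) := by ring
    rw [e, height_add θ (x - θ) q, height_add θ (x - θ) p, heq]
    have hs : 0 ≤ Real.sin (x - θ) :=
      Real.sin_nonneg_of_nonneg_of_le_pi (by linarith [hx.1]) (by linarith [hx.2])
    have := mul_le_mul_of_nonneg_left (h' heq.symm) hs
    linarith

/-- If the boundary of a half-plane is met simultaneously by the thresholds for `A` and for `k`
lines of `B`, and the half-plane encloses `k + 1` lines of `B`, then the threshold for `k` lines
of `B` does not exceed that for `A` after any small positive rotation. -/
lemma GenPos.eventually_threshold_le {A B : Finset (Set (ℝ × ℝ))}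
    (hlines : ∀ l ∈ A ∪ B, IsLine l) (hgp : GenPos (A ∪ B)) {n k : ℕ} {gA gB : ℝ → ℝ}
    (hA : ∀ θ t, gA θ < t ↔ ∃ A' ⊆ A, n ≤ A'.card ∧ incSet A' ⊆ {p | height θ p < t})
    (hB : ∀ θ t, gB θ ≤ t ↔ ∃ B' ⊆ B, k ≤ B'.card ∧ incSet B' ⊆ {p | height θ p ≤ t})
    {θ : ℝ} (hlt : ¬ ∃ B' ⊆ B, k ≤ B'.card ∧ incSet B' ⊆ {p | height θ p < gA θ})
    (hk : ∃ B' ⊆ B, k + 1 ≤ B'.card ∧ incSet B' ⊆ {p | height θ p ≤ gA θ}) :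
    ∀ᶠ x in 𝓝[>] θ, gB x ≤ gA x := by
  have hfin := hgp.incSet_finite
  obtain ⟨B', hB', hc, hle⟩ := hk
  have hBL : B' ⊆ A ∪ B := hB'.trans Finset.subset_union_right
  set S := {p ∈ incSet (A ∪ B) | height θ p = gA θ} with hS
  have hSfin : S.Finite := hfin.subset fun p hp => hp.1
  have hSne : S.Nonempty := by
    by_contra hemp
    refine hlt ⟨B', hB', by omega, fun p hp => ?_⟩
    have hp' : height θ p ≤ gA θ := hle hp
    refine show height θ p < gA θ from lt_of_le_of_ne hp' fun he => hemp ?_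
    exact ⟨p, incSet_mono hBL hp, he⟩
  obtain ⟨q, hqS, hqmin⟩ := Set.exists_min_image S (height (θ + Real.pi / 2)) hSfin hSne
  obtain ⟨l, hl, herase⟩ := hgp.exists_erase hlines hBL
    (Finset.card_pos.mp (by omega)) θ hqS.1
  have ev1 : ∀ᶠ x in 𝓝[>] θ, ∀ p ∈ incSet (A ∪ B), height θ q ≤ height θ p →
      height x q ≤ height x p := by
    rw [eventually_all_finite hfin]
    intro p hp
    by_cases hqp : height θ q ≤ height θ p
    · refine (eventually_height_le hqp fun he => ?_).mono fun x hx _ => hx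
      exact hqmin p ⟨hp, he.trans hqS.2⟩
    · exact Eventually.of_forall fun x hx => absurd hx hqp
  have ev2 : ∀ᶠ x in 𝓝[>] θ, ∀ p ∈ incSet (A ∪ B), height θ p < height θ q →
      height x p ≤ height x q := by
    rw [eventually_all_finite hfin]
    intro p hp
    by_cases hpq : height θ p < height θ q
    · exact (eventually_height_le hpq.le fun he => absurd he hpq.ne').mono fun x hx _ => hx
    · exact Eventually.of_forall fun x hx => absurd hx hpq
  filter_upwards [ev1, ev2] with x h1 h2
  have hBx : gB x ≤ height x q := by
    rw [hB]
    refine ⟨B'.erase l, (Finset.erase_subset _ _).trans hB', ?_, fun y hy => ?_⟩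
    · rw [Finset.card_erase_of_mem hl]; omega
    · have hyB := incSet_mono (Finset.erase_subset _ _) hy
      have hy_le : height θ y ≤ gA θ := hle hyB
      rcases hy_le.lt_or_eq with hy' | hy'
      · exact h2 y (incSet_mono hBL hyB) (by rw [hqS.2]; exact hy')
      · rw [herase y hy (hy'.trans hqS.2.symm)]
        exact le_refl (height x q)
  refine hBx.trans (not_lt.mp fun hlt' => ?_)
  obtain ⟨A', hA', hcA, hsub⟩ := (hA x _).1 hlt'
  apply lt_irrefl (gA θ)
  rw [hA θ]
  refine ⟨A', hA', hcA, fun p hp => ?_⟩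
  by_contra hge
  simp only [Set.mem_ofPred_eq, not_lt] at hge
  have hp' := h1 p (incSet_mono (hA'.trans Finset.subset_union_left) hp) (by rw [hqS.2]; exact hge)
  exact absurd (hsub hp) (not_lt.mpr hp')

/-- **Intermediate-value lemma for critical half-planes.** If `H` and `H'` are both
`r₁`-critical for `A`, with `μ_B(H) ≥ (2|B|/3)^{r₁/r} − 2` and
`μ_B(H') ≤ (2|B|/3)^{r₁/r} − 2`, then some `r₁`-critical half-plane `H''` for `A`
satisfies `μ_B(H'') = ⌈(2|B|/3)^{r₁/r}⌉ − 2`. -/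
theorem critical_sweep (A B : Finset (Set (ℝ × ℝ)))
    (hlines : ∀ ℓ ∈ A ∪ B, IsLine ℓ) (hgp : GenPos (A ∪ B))
    (r₁ r : ℕ) (hr : 2 ≤ r) (hr₁ : 1 ≤ r₁) (hr₁' : r₁ ≤ r - 1)
    (H H' : Set (ℝ × ℝ))
    (hH : IsCritical A r₁ r H) (hH' : IsCritical A r₁ r H')
    (hBH : (2 * B.card / 3 : ℝ) ^ ((r₁ : ℝ) / r) - 2 ≤ (mu B H : ℝ))
    (hBH' : (mu B H' : ℝ) ≤ (2 * B.card / 3 : ℝ) ^ ((r₁ : ℝ) / r) - 2) :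
    ∃ H'' : Set (ℝ × ℝ), IsCritical A r₁ r H'' ∧
      (mu B H'' : ℤ) = ⌈(2 * B.card / 3 : ℝ) ^ ((r₁ : ℝ) / r)⌉ - 2 := by
  set m : ℝ := (2 * A.card / 3 : ℝ) ^ ((r₁ : ℝ) / r) - 2 with hm
  set T : ℝ := (2 * B.card / 3 : ℝ) ^ ((r₁ : ℝ) / r) with hT
  set n := ⌈m⌉₊ with hn
  have hmn : ∀ c : ℕ, m ≤ (c : ℝ) ↔ n ≤ c := fun c => Nat.ceil_le.symm
  have hT0 : 0 ≤ T - 2 := (Nat.cast_nonneg _).trans hBH'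
  set k := ⌈T - 2⌉₊ with hk
  have hkT : ⌈T⌉ - 2 = (k : ℤ) := by
    rw [hk, Int.natCast_ceil_eq_ceil hT0]
    exact_mod_cast (Int.ceil_sub_ofNat T 2).symm
  rw [hkT]
  simp only [Nat.cast_inj]
  by_cases hk' : mu B H' = k
  · exact ⟨H', hH', hk'⟩
  have hkH : k ≤ mu B H := Nat.ceil_le.mpr hBH
  have hkH' : mu B H' < k := by
    refine lt_of_le_of_ne ?_ hk'
    exact_mod_cast hBH'.trans (Nat.le_ceil (T - 2))
  have hkB : k ≤ B.card := by
    obtain ⟨B', hB', hc, -⟩ := le_mu_iff.1 hkH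
    exact hc.trans (Finset.card_le_card hB')
  have hk2 : 2 ≤ k := by
    by_contra hlt
    obtain ⟨B', hB', hc⟩ := Finset.exists_subset_card_eq hkB
    have : k ≤ mu B H' := le_mu_iff.2
      ⟨B', hB', hc.ge, by rw [incSet_eq_empty (by omega)]; exact Set.empty_subset _⟩
    omega
  have hnA : n ≤ A.card := by
    obtain ⟨A', hA', -, hc⟩ := hH.2.1
    exact ((hmn _).1 hc).trans (Finset.card_le_card hA')
  have hn2 : 2 ≤ n := by
    by_contra hlt
    obtain ⟨A', hA', hc⟩ := Finset.exists_subset_card_eq hnA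
    exact hH.2.2 ⟨A', hA', by rw [incSet_eq_empty (by omega)]; exact Set.empty_subset _,
      (hmn _).2 hc.ge⟩
  obtain ⟨gA, hgA, hgA_le, hgA_lt⟩ :=
    hgp.exists_continuous_threshold Finset.subset_union_left hn2 hnA
  obtain ⟨gB, hgB, hgB_le, hgB_lt⟩ :=
    hgp.exists_continuous_threshold Finset.subset_union_right hk2 hkB
  have hcrit : ∀ θ t, IsCritical A r₁ r {p | height θ p ≤ t} ↔ gA θ = t := by
    intro θ t
    unfold IsCritical
    rw [← hm, interior_height_le]
    simp only [hmn]
    have e1 := hgA_le θ t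
    have e2 := hgA_lt θ t
    simp only [and_comm (a := n ≤ _)] at e1 e2
    rw [← e1, ← e2]
    exact ⟨fun h => le_antisymm h.2.1 (not_lt.mp h.2.2),
      fun h => ⟨isHalfPlane_height θ t, h.le, h.not_lt⟩⟩
  have hmuB : ∀ θ t, k ≤ mu B {p | height θ p ≤ t} ↔ gB θ ≤ t := fun θ t => by
    rw [le_mu_iff, hgB_le]
  obtain ⟨a, s, ha, ha', rfl⟩ := hH.1.exists_height
  obtain ⟨b, t, hb, hb', rfl⟩ := hH'.1.exists_height
  rw [hcrit] at hH hH'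
  subst hH hH'
  have hper : ∀ p, height (b + 2 * Real.pi) p = height b p := fun p => by simp [height]
  have hmono : a < b + 2 * Real.pi := by linarith
  have hga : gB a ≤ gA a := (hmuB _ _).1 hkH
  have hgb : gA (b + 2 * Real.pi) < gB (b + 2 * Real.pi) := by
    have hAb : gA (b + 2 * Real.pi) = gA b := by
      rw [← hcrit]
      simp only [hper]
      rw [hcrit]
    rw [← not_le, ← hmuB, hAb]
    simpa only [hper, not_le] using hkH'
  obtain ⟨θ, ⟨⟨hθa, hθb⟩, hθ⟩, hmax⟩ :=
    (isCompact_Icc.inter_right (isClosed_le hgB hgA)).exists_isGreatest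
      (s := Set.Icc a (b + 2 * Real.pi) ∩ {x | gB x ≤ gA x}) ⟨a, ⟨le_rfl, hmono.le⟩, hga⟩
  simp only [Set.mem_ofPred_eq] at hθ
  have hθb' : θ < b + 2 * Real.pi := lt_of_le_of_ne hθb fun h => by
    rw [h] at hθ
    exact absurd hθ (not_le.mpr hgb)
  have hafter : ∀ᶠ x in 𝓝[>] θ, gA x < gB x := by
    filter_upwards [Ioo_mem_nhdsGT hθb'] with x hx
    by_contra hle
    exact absurd (hmax ⟨⟨hθa.trans hx.1.le, hx.2.le⟩, not_lt.mp hle⟩) (not_le.mpr hx.1)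
  have hge : gA θ ≤ gB θ :=
    le_of_tendsto_of_tendsto (hgA.continuousAt.tendsto.mono_left nhdsWithin_le_nhds)
      (hgB.continuousAt.tendsto.mono_left nhdsWithin_le_nhds) (hafter.mono fun x hx => hx.le)
  refine ⟨{p | height θ p ≤ gA θ}, (hcrit _ _).2 rfl, le_antisymm ?_ ((hmuB _ _).2 hθ)⟩
  by_contra hgt
  have hk1 : k + 1 ≤ mu B {p | height θ p ≤ gA θ} := by omega
  have hev := hgp.eventually_threshold_le hlines hgA_lt hgB_le
    (fun h => absurd ((hgB_lt _ _).2 h) (not_lt.mpr hge)) (le_mu_iff.1 hk1)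
  obtain ⟨x, hx, hx'⟩ := (hev.and hafter).exists
  exact absurd hx (not_le.mpr hx')
end

section
/- Let r ≥ 2 be an integer and suppose every element of {1, 2, …, r−1} is assigned a sign (positive or negative). Then there exists either a pair (r₁, r₂) of elements of {1, …, r−1} with r₁ + r₂ = r and both of the same sign, or a triple (r₁, r₂, r₃) of elements of {1, …, r−1} with r₁ + r₂ + r₃ = r and all three of the same sign; moreover, the pair or triple can be chosen so that each of its entries is at most 2r/3. -/
/-- If no pair summing to the odd number `2 * m + 1` and no triple with that sum is monochromatic
(with entries at most two thirds of the sum), then the upper half of the middle third carries the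
sign of `1`. -/
lemma sign_upper_middle {m : ℕ} {sign : ℕ → Bool}
    (hpair : ∀ a b : ℕ, 1 ≤ a → 1 ≤ b → a + b = 2 * m + 1 → 3 * a ≤ 2 * (2 * m + 1) →
      3 * b ≤ 2 * (2 * m + 1) → sign a ≠ sign b)
    (htriple : ∀ a b c : ℕ, 1 ≤ a → 1 ≤ b → 1 ≤ c → a + b + c = 2 * m + 1 →
      3 * a ≤ 2 * (2 * m + 1) → 3 * b ≤ 2 * (2 * m + 1) → 3 * c ≤ 2 * (2 * m + 1) →
      sign a = sign b → sign b ≠ sign c)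
    (hm : 1 ≤ m) {a : ℕ} (hma : m + 1 ≤ a) (ha : 3 * a ≤ 2 * (2 * m + 1)) :
    sign a = sign 1 := by
  induction a, hma using Nat.le_induction with
  | base =>
    have h₁ := hpair m (m + 1) hm (by omega) (by omega) (by omega) ha
    have h₂ := htriple 1 m m le_rfl hm hm (by omega) (by omega) (by omega) (by omega)
    revert h₁ h₂
    cases sign 1 <;> cases sign m <;> cases sign (m + 1) <;> simp
  | succ a hma ih =>
    have h₁ := hpair (a + 1) (2 * m - a) (by omega) (by omega) (by omega) ha (by omega)
    have h₂ := htriple 1 a (2 * m - a) le_rfl (by omega) (by omega) (by omega) (by omega)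
      (by omega) (by omega)
    have h₃ := ih (by omega)
    revert h₁ h₂ h₃
    cases sign 1 <;> cases sign a <;> cases sign (a + 1) <;> cases sign (2 * m - a) <;> simp

/-- Some pair or triple of positive integers of the same sign sums to `r`, with entries at most
`2 * r / 3`. -/
lemma exists_signed_summands (r : ℕ) (hr : 2 ≤ r) (sign : ℕ → Bool) :
    (∃ a b : ℕ, 1 ≤ a ∧ 1 ≤ b ∧ a + b = r ∧ 3 * a ≤ 2 * r ∧ 3 * b ≤ 2 * r ∧ sign a = sign b) ∨
    (∃ a b c : ℕ, 1 ≤ a ∧ 1 ≤ b ∧ 1 ≤ c ∧ a + b + c = r ∧ 3 * a ≤ 2 * r ∧ 3 * b ≤ 2 * r ∧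
      3 * c ≤ 2 * r ∧ sign a = sign b ∧ sign b = sign c) := by
  by_contra! ⟨hpair, htriple⟩
  obtain ⟨m, rfl | rfl⟩ := Nat.even_or_odd' r
  · exact hpair m m (by omega) (by omega) (by omega) (by omega) (by omega) rfl
  have upper {a : ℕ} := sign_upper_middle hpair htriple (by omega) (a := a)
  obtain ⟨k, hk | hk | hk⟩ : ∃ k, 2 * m + 1 = 3 * k ∨ 2 * m + 1 = 3 * k + 1 ∨
      2 * m + 1 = 3 * k + 2 := ⟨(2 * m + 1) / 3, by omega⟩
  · exact htriple k k k (by omega) (by omega) (by omega) (by omega) (by omega) (by omega)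
      (by omega) rfl rfl
  · have h₁ := upper (a := 2 * k) (by omega) (by omega)
    have h₂ := hpair (k + 1) (2 * k) (by omega) (by omega) (by omega) (by omega) (by omega)
    have h₃ := htriple k k (k + 1) (by omega) (by omega) (by omega) (by omega) (by omega)
      (by omega) (by omega)
    have h₄ := htriple 1 k (2 * k) (by omega) (by omega) (by omega) (by omega) (by omega)
      (by omega) (by omega)
    revert h₁ h₂ h₃ h₄
    cases sign 1 <;> cases sign k <;> cases sign (k + 1) <;> cases sign (2 * k) <;> simp
  · have h₁ := upper (a := 2 * k + 1) (by omega) (by omega)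
    have h₂ := hpair (k + 1) (2 * k + 1) (by omega) (by omega) (by omega) (by omega) (by omega)
    have h₃ := htriple k (k + 1) (k + 1) (by omega) (by omega) (by omega) (by omega) (by omega)
      (by omega) (by omega)
    have h₄ := htriple 1 k (2 * k + 1) (by omega) (by omega) (by omega) (by omega) (by omega)
      (by omega) (by omega)
    revert h₁ h₂ h₃ h₄
    cases sign 1 <;> cases sign k <;> cases sign (k + 1) <;> cases sign (2 * k + 1) <;> simp

/-- **Signed summands** (Theorem 9 of Bespamyatnikh–Kirkpatrick–Snoeyink).
If every element of `{1, …, r−1}` is given a sign, then there is a pair or a triple of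
(not necessarily distinct) elements of `{1, …, r−1}` of the same sign whose sum is `r`;
moreover each entry can be taken at most `2r/3`. -/
theorem signed_summands (r : ℕ) (hr : 2 ≤ r) (sign : ℕ → Bool) :
    (∃ r₁ r₂ : ℕ, r₁ ∈ Finset.Icc 1 (r - 1) ∧ r₂ ∈ Finset.Icc 1 (r - 1) ∧
      r₁ + r₂ = r ∧ sign r₁ = sign r₂ ∧
      (r₁ : ℝ) ≤ 2 * r / 3 ∧ (r₂ : ℝ) ≤ 2 * r / 3) ∨
    (∃ r₁ r₂ r₃ : ℕ, r₁ ∈ Finset.Icc 1 (r - 1) ∧ r₂ ∈ Finset.Icc 1 (r - 1) ∧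
      r₃ ∈ Finset.Icc 1 (r - 1) ∧ r₁ + r₂ + r₃ = r ∧
      sign r₁ = sign r₂ ∧ sign r₂ = sign r₃ ∧
      (r₁ : ℝ) ≤ 2 * r / 3 ∧ (r₂ : ℝ) ≤ 2 * r / 3 ∧ (r₃ : ℝ) ≤ 2 * r / 3) := by
  have bound {a : ℕ} (ha : 3 * a ≤ 2 * r) : (a : ℝ) ≤ 2 * r / 3 := by
    have : (3 * a : ℝ) ≤ 2 * r := mod_cast ha
    linarith
  simp only [Finset.mem_Icc]
  obtain ⟨a, b, ha, hb, hab, ha', hb', hs⟩ | ⟨a, b, c, ha, hb, hc, habc, ha', hb', hc', hs, hs'⟩ :=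
    exists_signed_summands r hr sign
  · exact .inl ⟨a, b, by omega, by omega, hab, hs, bound ha', bound hb'⟩
  · exact .inr ⟨a, b, c, by omega, by omega, by omega, habc, hs, hs', bound ha', bound hb',
      bound hc'⟩
end

section
/- Let r ≥ 2 be an integer, let t₁ ≤ t₂ ≤ ⋯ ≤ t_{r−1} be real numbers, and let J₁, …, J_r be nonempty closed bounded intervals of ℝ such that every point of J_i is strictly less than every point of J_{i+1} for each i. Consider the r closed intervals S₀ = (−∞, t₁], S_i = [t_i, t_{i+1}] for 1 ≤ i ≤ r−2, and S_{r−1} = [t_{r−1}, ∞). Then at least one of the intervals S₀, …, S_{r−1} intersects at most one of the intervals J₁, …, J_r. -/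
open scoped Classical

/-- **Interval pigeonhole.** Given reals `t₁ ≤ ⋯ ≤ t_{r−1}` and nonempty closed bounded
intervals `J₁ < J₂ < ⋯ < J_r` (every point of `J_i` strictly below every point of
`J_{i+1}`), at least one of the closed intervals
`S₀ = (−∞, t₁]`, `S_i = [t_i, t_{i+1}]` (`1 ≤ i ≤ r−2`), `S_{r−1} = [t_{r−1}, ∞)`
meets at most one of `J₁, …, J_r`. -/
theorem interval_pigeonhole (r : ℕ) (hr : 2 ≤ r) (t : ℕ → ℝ)
    (ht : ∀ i, 1 ≤ i → i + 1 ≤ r - 1 → t i ≤ t (i + 1))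
    (J : ℕ → Set ℝ)
    (hJ : ∀ i, 1 ≤ i → i ≤ r → ∃ u v : ℝ, u ≤ v ∧ J i = Set.Icc u v)
    (hJlt : ∀ i, 1 ≤ i → i + 1 ≤ r → ∀ x ∈ J i, ∀ y ∈ J (i + 1), x < y)
    (S : ℕ → Set ℝ)
    (hS0 : S 0 = Set.Iic (t 1))
    (hSmid : ∀ i, 1 ≤ i → i ≤ r - 2 → S i = Set.Icc (t i) (t (i + 1)))
    (hSlast : S (r - 1) = Set.Ici (t (r - 1))) :
    ∃ i ≤ r - 1, ((Finset.Icc 1 r).filter fun j => (S i ∩ J j).Nonempty).card ≤ 1 := by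
  by_contra! hcon
  choose! u v huv hJeq using hJ
  have hlt : ∀ j k, 1 ≤ j → j < k → k ≤ r → v j < u k := by
    intro j k hj hjk
    induction k, hjk using Nat.le_induction with
    | base =>
      intro hk
      refine hJlt j hj hk _ ?_ _ ?_
      · rw [hJeq j hj (by omega)]
        exact Set.right_mem_Icc.2 (huv j hj (by omega))
      · rw [hJeq (j + 1) (by omega) hk]
        exact Set.left_mem_Icc.2 (huv (j + 1) (by omega) hk)
    | succ k hjk ih =>
      intro hk
      have hk' : v k < u (k + 1) := by
        refine hJlt k (by omega) hk _ ?_ _ ?_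
        · rw [hJeq k (by omega) (by omega)]
          exact Set.right_mem_Icc.2 (huv k (by omega) (by omega))
        · rw [hJeq (k + 1) (by omega) hk]
          exact Set.left_mem_Icc.2 (huv (k + 1) (by omega) hk)
      exact ((ih (by omega)).trans_le (huv k (by omega) (by omega))).trans hk'
  have hmono : ∀ j k, 1 ≤ j → j ≤ k → k ≤ r → u j ≤ u k := by
    intro j k hj hjk hk
    rcases hjk.eq_or_lt with rfl | h
    · exact le_rfl
    · exact (huv j hj (by omega)).trans (hlt j k hj h hk).le
  have htwo : ∀ i ≤ r - 1, ∃ a b, 1 ≤ a ∧ a < b ∧ b ≤ r ∧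
      (∃ x ∈ S i, x ≤ v a) ∧ ∃ y ∈ S i, u b ≤ y := by
    intro i hi
    obtain ⟨a, ha, b, hb, hab⟩ := Finset.one_lt_card.1 (hcon i hi)
    wlog h : a < b generalizing a b
    · exact this b hb a ha hab.symm (by omega)
    simp only [Finset.mem_filter, Finset.mem_Icc] at ha hb
    obtain ⟨⟨ha1, har⟩, x, hxS, hx⟩ := ha
    obtain ⟨⟨hb1, hbr⟩, y, hyS, hy⟩ := hb
    rw [hJeq a ha1 har] at hx
    rw [hJeq b hb1 hbr] at hy
    exact ⟨a, b, ha1, h, hbr, ⟨x, hxS, hx.2⟩, y, hyS, hy.1⟩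
  have hcut : ∀ i, i + 2 ≤ r → u (i + 2) ≤ t (i + 1) := by
    intro i
    induction i with
    | zero =>
      intro _
      obtain ⟨a, b, ha, hab, hb, -, y, hy, hby⟩ := htwo 0 (by omega)
      rw [hS0] at hy
      exact (hmono 2 b (by omega) (by omega) hb).trans (hby.trans hy)
    | succ i ih =>
      intro hi
      obtain ⟨a, b, ha, hab, hb, ⟨x, hx, hxa⟩, y, hy, hby⟩ := htwo (i + 1) (by omega)
      rw [hSmid (i + 1) (by omega) (by omega)] at hx hy
      have hle : i + 2 ≤ a := by
        by_contra! h
        linarith [hlt a (i + 2) ha h (by omega), ih (by omega), hx.1]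
      exact (hmono (i + 1 + 2) b (by omega) (by omega) hb).trans (hby.trans hy.2)
  obtain ⟨a, b, ha, hab, hb, ⟨x, hx, hxa⟩, -⟩ := htwo (r - 1) le_rfl
  rw [hSlast, Set.mem_Ici] at hx
  have hlast := hcut (r - 2) (by omega)
  rw [show r - 2 + 2 = r by omega, show r - 2 + 1 = r - 1 by omega] at hlast
  linarith [hlt a r ha (by omega) le_rfl]
end

section
/- Let A' be a finite set of pairwise non-parallel, non-vertical lines in ℝ² and let x₀ ∈ ℝ be such that the vertical line x = x₀ contains no intersection point of two lines of A'. If, when the lines of A' are ordered by the y-coordinate of their intersection with the line x = x₀ from bottom to top, their slopes form an increasing sequence, then I(A') ⊆ {(x, y) ∈ ℝ² : x ≤ x₀}; if instead the slopes form a decreasing sequence, then I(A') ⊆ {(x, y) ∈ ℝ² : x ≥ x₀}. -/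
/-- The incidence set of a family of non-vertical lines, each given by its
(slope, intercept) pair `l = (l.1, l.2)`, i.e. the line `y = l.1 · x + l.2`. -/
def incSetSlope (A : Finset (ℝ × ℝ)) : Set (ℝ × ℝ) :=
  {p | ∃ l₁ ∈ A, ∃ l₂ ∈ A, l₁ ≠ l₂ ∧
    p.2 = l₁.1 * p.1 + l₁.2 ∧ p.2 = l₂.1 * p.1 + l₂.2}

/-- **Monotone slopes and half-planes.** Let `A'` be a finite set of pairwise non-parallel
non-vertical lines, given by (slope, intercept) pairs, and `x₀ ∈ ℝ` such that the vertical
line `x = x₀` contains no intersection point of two lines of `A'`.  If, ordering the lines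
by the y-coordinate of their intersection with `x = x₀` from bottom to top, the slopes are
increasing, then `I(A') ⊆ {x ≤ x₀}`; if the slopes are decreasing, then
`I(A') ⊆ {x ≥ x₀}`. -/
theorem monotone_slopes (A' : Finset (ℝ × ℝ)) (x₀ : ℝ)
    (hpar : ∀ l₁ ∈ A', ∀ l₂ ∈ A', l₁ ≠ l₂ → l₁.1 ≠ l₂.1)
    (hx₀ : ∀ l₁ ∈ A', ∀ l₂ ∈ A', l₁ ≠ l₂ → l₁.1 * x₀ + l₁.2 ≠ l₂.1 * x₀ + l₂.2) :
    ((∀ l₁ ∈ A', ∀ l₂ ∈ A',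
        l₁.1 * x₀ + l₁.2 < l₂.1 * x₀ + l₂.2 → l₁.1 < l₂.1) →
      incSetSlope A' ⊆ {p : ℝ × ℝ | p.1 ≤ x₀}) ∧
    ((∀ l₁ ∈ A', ∀ l₂ ∈ A',
        l₁.1 * x₀ + l₁.2 < l₂.1 * x₀ + l₂.2 → l₂.1 < l₁.1) →
      incSetSlope A' ⊆ {p : ℝ × ℝ | x₀ ≤ p.1}) := by
  constructor
  · rintro h p ⟨l₁, h₁, l₂, h₂, hne, e₁, e₂⟩
    rw [Set.mem_ofPred_eq]
    by_contra! hp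
    rcases (hx₀ l₁ h₁ l₂ h₂ hne).lt_or_gt with hlt | hlt
    · nlinarith [mul_pos (sub_pos.2 hp) (sub_pos.2 (h l₁ h₁ l₂ h₂ hlt))]
    · nlinarith [mul_pos (sub_pos.2 hp) (sub_pos.2 (h l₂ h₂ l₁ h₁ hlt))]
  · rintro h p ⟨l₁, h₁, l₂, h₂, hne, e₁, e₂⟩
    rw [Set.mem_ofPred_eq]
    by_contra! hp
    rcases (hx₀ l₁ h₁ l₂ h₂ hne).lt_or_gt with hlt | hlt
    · nlinarith [mul_pos (sub_pos.2 hp) (sub_pos.2 (h l₁ h₁ l₂ h₂ hlt))]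
    · nlinarith [mul_pos (sub_pos.2 hp) (sub_pos.2 (h l₂ h₂ l₁ h₁ hlt))]
end
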